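/- Let f ∈ ℂ[x,y] be a squarefree (reduced) polynomial, written f = Σ_{i=0}^n f_i(x)·y^i with f_i ∈ ℂ[x], n = deg_y f, and f₀ ≠ 0, f_n ≠ 0. Suppose that for every a ∈ ℂ with a ≠ 0 one has f_n(a) ≠ 0, and there is no b ∈ ℂ with f(a,b) = 0 and b·(∂f/∂y)(a,b) = 0. Then f is quasi-homogeneous with the weight of x nonzero: there exist integers w, α, β with α ≠ 0 such that α·i + β·j = w for every monomial x^i y^j appearing in f with nonzero coefficient. -/

import Mathlib

open Polynomial

/-- Evaluation of a bivariate polynomial `f ∈ ℂ[x][y]` at the point `(a, b)`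
(with `x` the inner variable and `y` the outer one). -/
noncomputable def evalXY (a b : ℂ) (f : Polynomial (Polynomial ℂ)) : ℂ :=
  (f.map (evalRingHom a)).eval b

/-- A polynomial over `ℂ` without nonzero roots is a monomial. -/
theorem Polynomial.exists_eq_C_mul_X_pow_of_eval_ne_zero {p : ℂ[X]}
    (hp : ∀ x : ℂ, x ≠ 0 → p.eval x ≠ 0) :
    ∃ (c : ℂ) (k : ℕ), c ≠ 0 ∧ p = C c * X ^ k := by
  have hp0 : p ≠ 0 := by
    rintro rfl
    exact hp 1 one_ne_zero (by simp)
  refine ⟨p.leadingCoeff, p.natDegree, leadingCoeff_ne_zero.2 hp0, ?_⟩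
  have hroots : p.roots = Multiset.replicate p.natDegree 0 := by
    rw [Multiset.eq_replicate]
    refine ⟨IsAlgClosed.card_roots_eq_natDegree, fun b hb ↦ ?_⟩
    by_contra h
    exact hp b h ((mem_roots hp0).1 hb)
  have h := (IsAlgClosed.splits p).eq_prod_roots
  rw [hroots] at h
  simpa using h

/-- A Cauchy-type bound for the solutions of a polynomial equation `p(b) = w`. -/
theorem Polynomial.norm_le_of_natDegree_le {p : ℂ[X]} {n : ℕ} (hn : n ≠ 0)
    (hp : p.natDegree ≤ n) (hlead : p.coeff n ≠ 0) (b : ℂ) :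
    ‖b‖ ≤ 1 + (‖p.eval b‖ + ∑ i ∈ Finset.range n, ‖p.coeff i‖) / ‖p.coeff n‖ := by
  obtain h | h := le_total ‖b‖ 1
  · exact h.trans (le_add_of_nonneg_right (by positivity))
  have hpos : 0 < ‖p.coeff n‖ := norm_pos_iff.2 hlead
  obtain ⟨m, rfl⟩ := Nat.exists_eq_succ_of_ne_zero hn
  have heval : p.coeff (m + 1) * b ^ (m + 1)
      = p.eval b - ∑ i ∈ Finset.range (m + 1), p.coeff i * b ^ i := by
    rw [eval_eq_sum_range' (Nat.lt_succ_of_le hp), Finset.sum_range_succ _ (m + 1)]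
    ring
  have hb : 0 < ‖b‖ ^ m := by positivity
  have key : ‖p.coeff (m + 1)‖ * ‖b‖ * ‖b‖ ^ m
      ≤ (‖p.eval b‖ + ∑ i ∈ Finset.range (m + 1), ‖p.coeff i‖) * ‖b‖ ^ m := by
    calc ‖p.coeff (m + 1)‖ * ‖b‖ * ‖b‖ ^ m = ‖p.coeff (m + 1) * b ^ (m + 1)‖ := by
          rw [norm_mul, norm_pow, pow_succ]; ring
      _ ≤ ‖p.eval b‖ + ∑ i ∈ Finset.range (m + 1), ‖p.coeff i * b ^ i‖ := by
          rw [heval]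
          exact (norm_sub_le _ _).trans (by gcongr; exact norm_sum_le _ _)
      _ ≤ ‖p.eval b‖ * ‖b‖ ^ m + ∑ i ∈ Finset.range (m + 1), ‖p.coeff i‖ * ‖b‖ ^ m := by
          gcongr with i hi
          · exact le_mul_of_one_le_right (norm_nonneg _) (one_le_pow₀ h)
          · rw [norm_mul, norm_pow]
            gcongr
            exact Nat.lt_succ_iff.1 (Finset.mem_range.1 hi)
      _ = _ := by rw [add_mul, Finset.sum_mul]
  have := le_of_mul_le_mul_right key hb
  rw [mul_comm, ← le_div_iff₀ hpos] at this
  linarith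

theorem Complex.eq_of_forall_exp_mul_eq {u v : ℂ}
    (h : ∀ z : ℂ, Complex.exp (u * z) = Complex.exp (v * z)) : u = v := by
  have hd (w : ℂ) : deriv (fun z ↦ Complex.exp (w * z)) 0 = w := by
    simpa using (((hasDerivAt_id (0 : ℂ)).const_mul w).cexp).deriv
  rw [← hd u, ← hd v, funext h]

/-- An entire function of at most linear growth is affine. -/
theorem Complex.exists_eq_affine_of_norm_le {h : ℂ → ℂ} (hh : Differentiable ℂ h) {A B : ℝ}
    (hB : 0 ≤ B) (hbound : ∀ z, ‖h z‖ ≤ A + B * ‖z‖) : ∃ a, ∀ z, h z = h 0 + a * z := by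
  have h2 (c : ℂ) : deriv (deriv h) c = 0 := by
    have hle : ∀ R : ℝ, 0 < R →
        ‖iteratedDeriv 2 h c‖ ≤ 2 * ((A + B * ‖c‖) / R ^ 2 + B / R) := by
      intro R hR
      refine (Complex.norm_iteratedDeriv_le_of_forall_mem_sphere_norm_le
        (C := A + B * (‖c‖ + R)) 2 hR hh.diffContOnCl fun z hz ↦ ?_).trans (le_of_eq ?_)
      · have : ‖z‖ ≤ ‖c‖ + R := by
          have := norm_le_norm_add_norm_sub' z c
          rwa [mem_sphere_iff_norm.1 hz] at this
        exact (hbound z).trans (by gcongr)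
      · simp
        field_simp
        ring
    have hlim : Filter.Tendsto (fun R : ℝ ↦ 2 * ((A + B * ‖c‖) / R ^ 2 + B / R))
        Filter.atTop (nhds (2 * (0 + 0))) :=
      (((tendsto_const_nhds).div_atTop (Filter.tendsto_pow_atTop two_ne_zero)).add
        ((tendsto_const_nhds).div_atTop Filter.tendsto_id)).const_mul 2
    have h0 : ‖iteratedDeriv 2 h c‖ ≤ 2 * (0 + 0) :=
      ge_of_tendsto hlim ((Filter.eventually_gt_atTop 0).mono hle)
    rw [iteratedDeriv_succ, iteratedDeriv_one] at h0
    simpa using h0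
  have hconst (z : ℂ) : deriv h z = deriv h 0 :=
    is_const_of_deriv_eq_zero hh.deriv h2 z 0
  refine ⟨deriv h 0, fun z ↦ ?_⟩
  have hd (w : ℂ) : HasDerivAt (fun z ↦ h z - deriv h 0 * z) 0 w := by
    exact ((hh w).hasDerivAt.sub ((hasDerivAt_id w).const_mul (deriv h 0))).congr_deriv
      (by simp [hconst w])
  have := is_const_of_deriv_eq_zero (fun w ↦ (hd w).differentiableAt) (fun w ↦ (hd w).deriv) z 0
  simp only [mul_zero, sub_zero] at this
  linear_combination this

/-- An entire function without zeros has an entire logarithm. -/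
theorem Complex.exists_eq_exp_of_ne_zero {g : ℂ → ℂ} (hg : Differentiable ℂ g)
    (hg0 : ∀ z, g z ≠ 0) :
    ∃ h : ℂ → ℂ, Differentiable ℂ h ∧ ∀ z, g z = Complex.exp (h z) := by
  have hq : Differentiable ℂ fun z ↦ deriv g z / g z := hg.deriv.div hg hg0
  obtain ⟨h, hh0, hh⟩ := hq.isExactOn_univ.with_val_at 0 (Complex.log (g 0))
  have hhd : Differentiable ℂ h := fun z ↦ (hh z trivial).differentiableAt
  refine ⟨h, hhd, fun z ↦ ?_⟩
  have hd (w : ℂ) : HasDerivAt (fun z ↦ g z * Complex.exp (-h z)) 0 w := by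
    have := hg0 w
    refine ((hg w).hasDerivAt.mul (hh w trivial).neg.cexp).congr_deriv ?_
    simp only [Pi.neg_apply]
    field_simp
    ring
  have := is_const_of_deriv_eq_zero (fun w ↦ (hd w).differentiableAt) (fun w ↦ (hd w).deriv) z 0
  simp only [hh0, Complex.exp_neg, Complex.exp_log (hg0 0), mul_inv_cancel₀ (hg0 0)] at this
  field_simp at this
  exact this

/-- An entire function without zeros of exponential type is an exponential. -/
theorem Complex.exists_eq_mul_exp_of_norm_le {g : ℂ → ℂ} (hg : Differentiable ℂ g)
    (hg0 : ∀ z, g z ≠ 0) {M B : ℝ} (hB : 0 ≤ B) (hbound : ∀ z, ‖g z‖ ≤ M * Real.exp (B * ‖z‖)) :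
    ∃ a, ∀ z, g z = g 0 * Complex.exp (a * z) := by
  obtain ⟨h, hh, hgh⟩ := exists_eq_exp_of_ne_zero hg hg0
  have hM : 0 < M := by
    simpa using (norm_pos_iff.2 (hg0 0)).trans_le (hbound 0)
  have hre (z : ℂ) : (h z).re ≤ Real.log M + B * ‖z‖ := by
    have := hbound z
    rw [hgh, Complex.norm_exp] at this
    rwa [← Real.exp_le_exp, Real.exp_add, Real.exp_log hM]
  obtain ⟨a, ha⟩ : ∃ a, ∀ z, h z = h 0 + a * z := by
    set L := |Real.log M| + 1
    have hL : 0 < L := by positivity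
    refine exists_eq_affine_of_norm_le hh (A := 2 * (L + B) + 3 * ‖h 0‖) (B := 4 * B)
      (by positivity) fun z ↦ ?_
    have hR : 0 < 2 * ‖z‖ + 1 := by positivity
    have hb := Complex.borelCaratheodory (f := h) (M := L + B * (2 * ‖z‖ + 1)) (z := z)
      (by positivity) hh.differentiableOn (fun w hw ↦ ?_) hR (by simp; linarith [norm_nonneg z])
    · refine hb.trans ?_
      have hpos : 0 < 2 * ‖z‖ + 1 - ‖z‖ := by linarith [norm_nonneg z]
      rw [← add_div, div_le_iff₀ hpos]
      have h1 := norm_nonneg z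
      have h2 := norm_nonneg (h 0)
      nlinarith [mul_nonneg hB h1, mul_nonneg hL.le h1, mul_nonneg h2 h1,
        mul_nonneg (mul_nonneg hB h1) h1]
    · have hw' : ‖w‖ ≤ 2 * ‖z‖ + 1 := by simpa using (mem_ball_zero_iff.1 hw).le
      calc (h w).re ≤ Real.log M + B * ‖w‖ := hre w
        _ ≤ L + B * (2 * ‖z‖ + 1) := by
          gcongr
          linarith [le_abs_self (Real.log M)]
  refine ⟨a, fun z ↦ ?_⟩
  rw [hgh z, hgh 0, ha z, Complex.exp_add]

section RootFamily

variable {P : ℂ → ℂ[X]} {n : ℕ}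

/-- Evaluation of a family of polynomials of bounded degree with entire coefficients is smooth. -/
theorem contDiff_eval_of_differentiable_coeff (hdeg : ∀ z, (P z).natDegree ≤ n)
    (hcoeff : ∀ i, Differentiable ℂ fun z ↦ (P z).coeff i) :
    ContDiff ℂ 1 fun u : ℂ × ℂ ↦ (P u.1).eval u.2 := by
  have h : (fun u : ℂ × ℂ ↦ (P u.1).eval u.2)
      = fun u ↦ ∑ i ∈ Finset.range (n + 1), (P u.1).coeff i * u.2 ^ i :=
    funext fun u ↦ eval_eq_sum_range' (Nat.lt_succ_of_le (hdeg u.1)) u.2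
  rw [h]
  refine ContDiff.sum fun i _ ↦ ?_
  exact ((hcoeff i).contDiff.comp contDiff_fst).mul (contDiff_snd.pow i)

theorem isInvertible_fderiv_eval_comp_inr (hdeg : ∀ z, (P z).natDegree ≤ n)
    (hcoeff : ∀ i, Differentiable ℂ fun z ↦ (P z).coeff i) {u : ℂ × ℂ}
    (hu : (P u.1).derivative.eval u.2 ≠ 0) :
    (fderiv ℂ (fun u : ℂ × ℂ ↦ (P u.1).eval u.2) u ∘L .inr ℂ ℂ ℂ).IsInvertible := by
  set L := fderiv ℂ (fun u : ℂ × ℂ ↦ (P u.1).eval u.2) u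
  have hF : HasFDerivAt (fun u : ℂ × ℂ ↦ (P u.1).eval u.2) L (u.1, u.2) :=
    ((contDiff_eval_of_differentiable_coeff hdeg hcoeff).differentiable one_ne_zero u).hasFDerivAt
  have h1 : HasFDerivAt (fun y ↦ (P u.1).eval y) (L ∘L .inr ℂ ℂ ℂ) u.2 :=
    hF.comp u.2 (hasFDerivAt_prodMk_right u.1 u.2)
  have h2 := ((P u.1).hasDerivAt u.2).hasFDerivAt_equiv hu
  rw [h1.unique h2]
  exact ContinuousLinearMap.isInvertible_equiv

/-- The map `(z, y) ↦ (P z (y), z)` is proper. -/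
theorem isProperMap_eval_prodMk (hn : n ≠ 0) (hdeg : ∀ z, (P z).natDegree ≤ n)
    (hcoeff : ∀ i, Differentiable ℂ fun z ↦ (P z).coeff i) (hlead : ∀ z, (P z).coeff n ≠ 0) :
    IsProperMap fun u : ℂ × ℂ ↦ ((P u.1).eval u.2, u.1) := by
  have hcont : Continuous fun u : ℂ × ℂ ↦ ((P u.1).eval u.2, u.1) :=
    (contDiff_eval_of_differentiable_coeff hdeg hcoeff).continuous.prodMk continuous_fst
  refine isProperMap_iff_isCompact_preimage.2 ⟨hcont, fun K hK ↦ ?_⟩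
  let b : ℂ × ℂ → ℝ := fun v ↦
    1 + (‖v.1‖ + ∑ i ∈ Finset.range n, ‖(P v.2).coeff i‖) / ‖(P v.2).coeff n‖
  have hb : Continuous b := by
    have h (i : ℕ) : Continuous fun v : ℂ × ℂ ↦ ‖(P v.2).coeff i‖ :=
      ((hcoeff i).continuous.comp continuous_snd).norm
    exact continuous_const.add (((continuous_fst.norm).add
      (continuous_finsetSum _ fun i _ ↦ h i)).div (h n) fun v ↦ norm_ne_zero_iff.2 (hlead v.2))
  obtain ⟨R, hR⟩ := (hK.image hb).bddAbove
  refine ((hK.image continuous_snd).prod (isCompact_closedBall (0 : ℂ) R)).of_isClosed_subset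
    (hK.isClosed.preimage hcont) fun u hu ↦ ⟨⟨_, hu, rfl⟩, ?_⟩
  rw [mem_closedBall_zero_iff]
  exact (norm_le_of_natDegree_le hn (hdeg u.1) (hlead u.1) u.2).trans (hR ⟨_, hu, rfl⟩)

/-- The zero locus of a family of separable polynomials with invertible leading coefficient
is a covering of the base. -/
theorem isCoveringMapOn_eval_prodMk (hn : n ≠ 0) (hdeg : ∀ z, (P z).natDegree ≤ n)
    (hcoeff : ∀ i, Differentiable ℂ fun z ↦ (P z).coeff i) (hlead : ∀ z, (P z).coeff n ≠ 0)
    (hsimple : ∀ z b, (P z).eval b = 0 → (P z).derivative.eval b ≠ 0) :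
    IsCoveringMapOn (fun u : ℂ × ℂ ↦ ((P u.1).eval u.2, u.1)) {v | v.1 = 0} := by
  have hclosed := (isProperMap_eval_prodMk hn hdeg hcoeff hlead).isClosedMap
  refine hclosed.isCoveringMapOn_of_isLocalHomeomorphOn (fun v hv ↦ ?_) fun u hu ↦ ?_
  · have hP : P v.2 ≠ 0 := fun h ↦ hlead v.2 (by simp [h])
    refine (((P v.2).roots.toFinset.finite_toSet.image fun y ↦ (v.2, y))).subset fun u hu ↦ ?_
    obtain rfl : _ = v := hu
    exact ⟨u.2, by simpa [hP] using hv, rfl⟩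
  · have hF := (contDiff_eval_of_differentiable_coeff hdeg hcoeff).contDiffAt (x := u)
    let φ := (hF.hasStrictFDerivAt one_ne_zero).implicitFunctionDataOfProdDomain
      (isInvertible_fderiv_eval_comp_inr hdeg hcoeff (hsimple u.1 u.2 hu))
    exact ⟨φ.toOpenPartialHomeomorph, φ.pt_mem_toOpenPartialHomeomorph_source, rfl⟩

theorem differentiable_of_eval_eq_zero (hdeg : ∀ z, (P z).natDegree ≤ n)
    (hcoeff : ∀ i, Differentiable ℂ fun z ↦ (P z).coeff i)
    (hsimple : ∀ z b, (P z).eval b = 0 → (P z).derivative.eval b ≠ 0)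
    {y : ℂ → ℂ} (hy : Continuous y) (hroot : ∀ z, (P z).eval (y z) = 0) :
    Differentiable ℂ y := by
  intro z
  have hF := (contDiff_eval_of_differentiable_coeff hdeg hcoeff).contDiffAt (x := (z, y z))
  have hinv := isInvertible_fderiv_eval_comp_inr hdeg hcoeff (u := (z, y z))
    (hsimple z (y z) (hroot z))
  have ht : Filter.Tendsto (fun w ↦ (w, y w)) (nhds z) (nhds (z, y z)) :=
    (continuous_id.prodMk hy).continuousAt
  have hev := ht.eventually (hF.eventually_apply_eq_iff_implicitFunction one_ne_zero hinv)
  refine ((hF.contDiffAt_implicitFunction one_ne_zero hinv).differentiableAt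
    one_ne_zero).congr_of_eventuallyEq (hev.mono fun w hw ↦ ?_)
  exact (hw.1 (by simp [hroot])).symm

/-- Every root of a member of the family extends uniquely to a global holomorphic root. -/
theorem existsUnique_root_section (hn : n ≠ 0) (hdeg : ∀ z, (P z).natDegree ≤ n)
    (hcoeff : ∀ i, Differentiable ℂ fun z ↦ (P z).coeff i) (hlead : ∀ z, (P z).coeff n ≠ 0)
    (hsimple : ∀ z b, (P z).eval b = 0 → (P z).derivative.eval b ≠ 0)
    {z₀ b : ℂ} (hb : (P z₀).eval b = 0) :
    ∃! y : ℂ → ℂ, Differentiable ℂ y ∧ y z₀ = b ∧ ∀ z, (P z).eval (y z) = 0 := by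
  have cov := isCoveringMapOn_eval_prodMk hn hdeg hcoeff hlead hsimple
  have hunique := cov.existsUnique_continuousMap_lifts
    (f := ⟨fun z : ℂ ↦ ((0 : ℂ), z), by fun_prop⟩) (a₀ := z₀) (e₀ := (z₀, b)) (by simp [hb])
    fun _ ↦ rfl
  obtain ⟨F, ⟨hF0, hF⟩, huniq⟩ := hunique
  have hF1 (z : ℂ) : (F z).1 = z := congrArg Prod.snd (congrFun hF z)
  have hF2 (z : ℂ) : (P z).eval (F z).2 = 0 := by
    simpa [hF1 z] using congrArg Prod.fst (congrFun hF z)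
  refine ⟨fun z ↦ (F z).2, ⟨?_, by simp [hF0], hF2⟩, ?_⟩
  · exact differentiable_of_eval_eq_zero hdeg hcoeff hsimple (by fun_prop) hF2
  · rintro y ⟨hy, hy0, hyr⟩
    have hyc := hy.continuous
    have := huniq ⟨fun z ↦ (z, y z), by fun_prop⟩
      ⟨by simp [hy0], funext fun z ↦ by simp [hyr]⟩
    funext z
    rw [← this]
    rfl

end RootFamily

theorem Polynomial.exists_norm_eval_exp_le (p : ℂ[X]) :
    ∃ M B : ℝ, 0 ≤ M ∧ 0 ≤ B ∧ ∀ z : ℂ, ‖p.eval (Complex.exp z)‖ ≤ M * Real.exp (B * ‖z‖) := by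
  refine ⟨∑ i ∈ Finset.range (p.natDegree + 1), ‖p.coeff i‖, p.natDegree, by positivity,
    by positivity, fun z ↦ ?_⟩
  rw [eval_eq_sum_range, Finset.sum_mul]
  refine (norm_sum_le _ _).trans (Finset.sum_le_sum fun i hi ↦ ?_)
  rw [norm_mul, norm_pow, Complex.norm_exp, ← Real.exp_nat_mul]
  have hi' : i ≤ p.natDegree := Nat.lt_succ_iff.1 (Finset.mem_range.1 hi)
  have hz : i * z.re ≤ p.natDegree * ‖z‖ :=
    (mul_le_mul_of_nonneg_left (Complex.re_le_norm z) i.cast_nonneg).trans (by gcongr)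
  gcongr

/-- If the leading coefficient is a monomial, the roots over `exp z` grow at most exponentially. -/
theorem exists_norm_root_le_mul_exp {f : ℂ[X][X]} {n k : ℕ} (hn : n ≠ 0) (hdeg : f.natDegree ≤ n)
    {c : ℂ} (hc : c ≠ 0) (hlead : f.coeff n = C c * X ^ k) :
    ∃ M B : ℝ, 0 ≤ B ∧ ∀ z b : ℂ, (f.map (evalRingHom (Complex.exp z))).eval b = 0 →
      ‖b‖ ≤ M * Real.exp (B * ‖z‖) := by
  choose M B hM hB hMB using fun i ↦ (f.coeff i).exists_norm_eval_exp_le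
  set S := ∑ i ∈ Finset.range n, M i
  set T := ∑ i ∈ Finset.range n, B i
  have hS : 0 ≤ S := Finset.sum_nonneg fun i _ ↦ hM i
  have hT : 0 ≤ T := Finset.sum_nonneg fun i _ ↦ hB i
  refine ⟨1 + S / ‖c‖, T + k, by positivity, fun z b hb ↦ ?_⟩
  have hlead' : (f.map (evalRingHom (Complex.exp z))).coeff n = c * Complex.exp z ^ k := by
    simp [hlead]
  have hle := norm_le_of_natDegree_le hn (natDegree_map_le.trans hdeg)
    (by rw [hlead']; exact mul_ne_zero hc (pow_ne_zero _ (Complex.exp_ne_zero z))) b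
  rw [hb, hlead', norm_zero, zero_add] at hle
  have hsum : ∑ i ∈ Finset.range n, ‖(f.map (evalRingHom (Complex.exp z))).coeff i‖
      ≤ S * Real.exp (T * ‖z‖) := by
    rw [Finset.sum_mul]
    refine Finset.sum_le_sum fun i hi ↦ ?_
    rw [coeff_map, coe_evalRingHom]
    refine (hMB i z).trans ?_
    have := hM i
    gcongr
    exact Finset.single_le_sum (fun j _ ↦ hB j) hi
  have hnorm : ‖c‖ * Real.exp (-(k * ‖z‖)) ≤ ‖c * Complex.exp z ^ k‖ := by
    rw [norm_mul, norm_pow, Complex.norm_exp, ← Real.exp_nat_mul, ← mul_neg]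
    gcongr
    exact neg_le_of_abs_le (Complex.abs_re_le_norm z)
  have hc' : 0 < ‖c‖ := norm_pos_iff.2 hc
  calc ‖b‖ ≤ 1 + S * Real.exp (T * ‖z‖) / (‖c‖ * Real.exp (-(k * ‖z‖))) := by
        refine hle.trans ?_
        gcongr
    _ = 1 + S / ‖c‖ * Real.exp ((T + k) * ‖z‖) := by
        rw [add_mul, Real.exp_add, Real.exp_neg]
        field_simp
    _ ≤ (1 + S / ‖c‖) * Real.exp ((T + k) * ‖z‖) := by
        rw [add_mul 1 (S / ‖c‖), one_mul]
        gcongr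
        exact Real.one_le_exp (by positivity)

/-- The roots of `f (exp z, ·)` are exponentials `b * exp (a * z)` with a common exponent `a`. -/
theorem exists_exponent_of_simple_roots {f : ℂ[X][X]} {n k : ℕ} (hn : n ≠ 0)
    (hdeg : f.natDegree = n) {c : ℂ} (hc : c ≠ 0) (hlead : f.coeff n = C c * X ^ k)
    (hcoeff0 : ∀ x : ℂ, x ≠ 0 → (f.coeff 0).eval x ≠ 0)
    (hsimple : ∀ x b : ℂ, x ≠ 0 → (f.map (evalRingHom x)).eval b = 0 →
      (f.map (evalRingHom x)).derivative.eval b ≠ 0) :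
    ∃ a : ℂ, ∀ b, (f.map (evalRingHom 1)).eval b = 0 →
      ∀ z, (f.map (evalRingHom (Complex.exp z))).eval (b * Complex.exp (a * z)) = 0 := by
  obtain ⟨M, B, hB, hbound⟩ := exists_norm_root_le_mul_exp hn hdeg.le hc hlead
  set P : ℂ → ℂ[X] := fun z ↦ f.map (evalRingHom (Complex.exp z))
  have hP0 : P 0 = f.map (evalRingHom 1) := by simp [P]
  have hPlead (z : ℂ) : (P z).coeff n ≠ 0 := by
    simp [P, hlead, hc]
  have hunique {z₀ b : ℂ} := existsUnique_root_section (P := P) (z₀ := z₀) (b := b) hn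
    (fun z ↦ natDegree_map_le.trans hdeg.le)
    (fun i ↦ by
      simp only [P, coeff_map, coe_evalRingHom]
      exact (f.coeff i).differentiable.comp Complex.differentiable_exp)
    hPlead (fun z b ↦ hsimple _ b (Complex.exp_ne_zero z))
  have hne (z b : ℂ) (hb : (P z).eval b = 0) : b ≠ 0 := by
    rintro rfl
    refine hcoeff0 _ (Complex.exp_ne_zero z) ?_
    rwa [← coeff_zero_eq_eval_zero, coeff_map] at hb
  have hexp (b : ℂ) (hb : (P 0).eval b = 0) :
      ∃ a, ∀ z, (P z).eval (b * Complex.exp (a * z)) = 0 := by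
    obtain ⟨y, hy, hy0, hyr⟩ := (hunique hb).exists
    obtain ⟨a, ha⟩ := Complex.exists_eq_mul_exp_of_norm_le hy (fun z ↦ hne z _ (hyr z)) hB
      fun z ↦ hbound z _ (hyr z)
    refine ⟨a, fun z ↦ ?_⟩
    rw [← hy0, ← ha]
    exact hyr z
  obtain ⟨b₀, hb₀⟩ := IsAlgClosed.exists_root (P 0) (by
    refine (natDegree_pos_iff_degree_pos.1 ?_).ne'
    exact (Nat.pos_of_ne_zero hn).trans_le (le_natDegree_of_ne_zero (hPlead 0)))
  obtain ⟨a₀, ha₀⟩ := hexp b₀ hb₀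
  refine ⟨a₀, fun b hb ↦ ?_⟩
  rw [← hP0] at hb
  obtain ⟨a, ha⟩ := hexp b hb
  suffices a = a₀ from this ▸ ha
  by_contra haa
  have hb0 := hne 0 b hb
  have hb₀0 := hne 0 b₀ hb₀
  have haa' : a - a₀ ≠ 0 := sub_ne_zero.2 haa
  have hmeet : b * Complex.exp (a * (Complex.log (b₀ / b) / (a - a₀)))
      = b₀ * Complex.exp (a₀ * (Complex.log (b₀ / b) / (a - a₀))) := by
    have : a * (Complex.log (b₀ / b) / (a - a₀))
        = Complex.log (b₀ / b) + a₀ * (Complex.log (b₀ / b) / (a - a₀)) := by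
      field_simp
      ring
    rw [this, Complex.exp_add, Complex.exp_log (div_ne_zero hb₀0 hb0)]
    field_simp
  have heq := (hunique (ha₀ _)).unique ⟨by fun_prop, hmeet, ha⟩ ⟨by fun_prop, rfl, ha₀⟩
  have hbb : b = b₀ := by simpa using congrFun heq 0
  refine haa (Complex.eq_of_forall_exp_mul_eq fun z ↦ ?_)
  have := congrFun heq z
  simp only [hbb] at this
  exact mul_left_cancel₀ hb₀0 this

/-- A polynomial with simple roots is determined, up to a constant, by its roots: if dilation by
`e` sends the roots of `p` to roots of `q`, then the coefficients correspond. -/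
theorem Polynomial.coeff_mul_pow_mul_coeff_eq {p q : ℂ[X]} {n : ℕ} (hp : p.natDegree = n)
    (hq : q.natDegree ≤ n) (hp0 : p ≠ 0)
    (hsimple : ∀ b, p.eval b = 0 → p.derivative.eval b ≠ 0) {e : ℂ}
    (hroots : ∀ b, p.eval b = 0 → q.eval (b * e) = 0) (i : ℕ) :
    q.coeff i * e ^ i * p.coeff n = p.coeff i * (q.coeff n * e ^ n) := by
  have hnodup : p.roots.Nodup := by
    refine Multiset.nodup_iff_count_le_one.2 fun b ↦ ?_
    rw [count_roots]
    by_contra! h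
    obtain ⟨h1, h2⟩ := (one_lt_rootMultiplicity_iff_isRoot hp0).1 h
    exact hsimple b h1 h2
  have hcard : p.roots.toFinset.card = n := by
    rw [Multiset.toFinset_card_of_nodup hnodup, IsAlgClosed.card_roots_eq_natDegree, hp]
  let r := q.comp (C e * X) * C (p.coeff n) - p * C (q.coeff n * e ^ n)
  have hr (j : ℕ) :
      r.coeff j = q.coeff j * e ^ j * p.coeff n - p.coeff j * (q.coeff n * e ^ n) := by
    simp only [r, coeff_sub, coeff_mul_C, comp_C_mul_X_coeff]
  have hr0 : r = 0 := by
    refine eq_zero_of_degree_lt_of_eval_finset_eq_zero p.roots.toFinset ?_ fun b hb ↦ ?_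
    · rw [hcard, degree_lt_iff_coeff_zero]
      intro j hj
      rw [hr]
      obtain rfl | hj := hj.eq_or_lt
      · ring
      · rw [coeff_eq_zero_of_natDegree_lt (hq.trans_lt hj),
          coeff_eq_zero_of_natDegree_lt (hp.trans_lt hj)]
        ring
    · have hb' : p.eval b = 0 := by simpa [hp0] using hb
      simp [r, hb', mul_comm e b, hroots b hb']
  have := hr i
  rw [hr0, coeff_zero] at this
  exact sub_eq_zero.1 this.symm

/-- The hard implication (C) ⇒ (A) of the main theorem: if for every `a ∈ ℂ^×` one has
`f_n(a) ≠ 0` and there is no `b ∈ ℂ` with `f(a,b) = 0` and `b ⬝ (∂f/∂y)(a,b) = 0`, then the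
reduced polynomial `f` is quasi-homogeneous with nonzero weight of `x`. -/
theorem quasiHomogeneous_of_no_common_zero
    (f : Polynomial (Polynomial ℂ)) (n : ℕ) (hn : n = f.natDegree)
    (hsf : Squarefree f) (h0 : f.coeff 0 ≠ 0) (hN : f.coeff n ≠ 0)
    (hC : ∀ a : ℂ, a ≠ 0 →
      (f.coeff n).eval a ≠ 0 ∧
        ¬ ∃ b : ℂ, evalXY a b f = 0 ∧ b * evalXY a b (derivative f) = 0) :
    ∃ w α β : ℤ, α ≠ 0 ∧
      ∀ i j : ℕ, (f.coeff j).coeff i ≠ 0 → α * (i : ℤ) + β * (j : ℤ) = w := by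
  obtain ⟨c, k, hc, hlead⟩ := exists_eq_C_mul_X_pow_of_eval_ne_zero fun x hx ↦ (hC x hx).1
  obtain rfl | hn0 := eq_or_ne n 0
  · refine ⟨k, 1, 0, one_ne_zero, fun i j hij ↦ ?_⟩
    obtain rfl : j = 0 := by
      by_contra hj
      have hfj : f.coeff j = 0 := coeff_eq_zero_of_natDegree_lt (by omega)
      exact hij (by rw [hfj, coeff_zero])
    have hik : i = k := by
      by_contra hik
      exact hij (by rw [hlead, coeff_C_mul_X_pow, if_neg hik])
    simp [hik]
  have hcoeff0 (x : ℂ) (hx : x ≠ 0) : (f.coeff 0).eval x ≠ 0 := fun h ↦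
    (hC x hx).2 ⟨0, by rw [evalXY, ← coeff_zero_eq_eval_zero, coeff_map, coe_evalRingHom, h],
      zero_mul _⟩
  have hsimple (x b : ℂ) (hx : x ≠ 0) (hb : (f.map (evalRingHom x)).eval b = 0) :
      (f.map (evalRingHom x)).derivative.eval b ≠ 0 := fun h ↦
    (hC x hx).2 ⟨b, hb, by rw [evalXY, ← derivative_map, h, mul_zero]⟩
  obtain ⟨a, ha⟩ := exists_exponent_of_simple_roots hn0 hn.symm hc hlead hcoeff0 hsimple
  have hp1 : (f.map (evalRingHom 1)).coeff n ≠ 0 := by simp [hlead, hc]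
  have hrel (i : ℕ) (z : ℂ) : (f.coeff i).eval (Complex.exp z) * Complex.exp (i * a * z)
      = (f.coeff i).eval 1 * Complex.exp ((k + n * a) * z) := by
    have h := coeff_mul_pow_mul_coeff_eq (p := f.map (evalRingHom 1))
      (q := f.map (evalRingHom (Complex.exp z))) (n := n)
      (le_antisymm (natDegree_map_le.trans hn.ge) (le_natDegree_of_ne_zero hp1))
      (natDegree_map_le.trans hn.ge) (fun h ↦ hp1 (by simp [h]))
      (fun b ↦ hsimple 1 b one_ne_zero) (fun b hb ↦ ha b hb z) i
    simp only [coeff_map, coe_evalRingHom, hlead, eval_mul, eval_C, eval_pow, eval_X, one_pow,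
      mul_one, ← Complex.exp_nat_mul] at h
    refine mul_right_cancel₀ hc ?_
    rw [show (k + n * a) * z = k * z + n * (a * z) by ring, Complex.exp_add, mul_assoc (i : ℂ), h]
    ring
  have hmono (i m : ℕ) (hm : (f.coeff i).coeff m ≠ 0) : (m : ℂ) + i * a = k + n * a := by
    have h1 : (f.coeff i).eval 1 ≠ 0 := by
      intro h1
      have hfi : f.coeff i = 0 := by
        refine eq_zero_of_infinite_isRoot _
          ((Set.infinite_of_finite_compl (s := {(0 : ℂ)}ᶜ) (by simp)).mono fun x hx ↦ ?_)
        have := hrel i (Complex.log x)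
        rw [h1, zero_mul, Complex.exp_log hx] at this
        exact (mul_eq_zero.1 this).resolve_right (Complex.exp_ne_zero _)
      exact hm (by rw [hfi, coeff_zero])
    obtain ⟨d, l, hd, hl⟩ := exists_eq_C_mul_X_pow_of_eval_ne_zero (p := f.coeff i) fun x hx h ↦ by
      have := hrel i (Complex.log x)
      rw [Complex.exp_log hx, h, zero_mul] at this
      exact mul_ne_zero h1 (Complex.exp_ne_zero _) this.symm
    obtain rfl : m = l := by
      by_contra hml
      exact hm (by rw [hl, coeff_C_mul_X_pow, if_neg hml])
    refine Complex.eq_of_forall_exp_mul_eq fun z ↦ mul_left_cancel₀ hd ?_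
    have := hrel i z
    simp only [hl, eval_mul, eval_C, eval_pow, eval_X, one_pow, mul_one, mul_assoc] at this
    rw [← this, add_mul, Complex.exp_add, Complex.exp_nat_mul]
    ring_nf
  obtain ⟨d, l, hd, hl⟩ := exists_eq_C_mul_X_pow_of_eval_ne_zero hcoeff0
  have hl0 : (l : ℂ) = k + n * a := by simpa using hmono 0 l (by simp [hl, hd])
  refine ⟨n * l, n, l - k, by exact_mod_cast hn0, fun m i hm ↦ ?_⟩
  have := hmono i m hm
  have key : (n : ℂ) * m + (l - k) * i = n * l := by
    linear_combination (n : ℂ) * this + (i - n : ℂ) * hl0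
  exact_mod_cast key
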